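/- Let N ≥ 1 and n ≥ 1 be integers. Then ∫₀¹ (1−t)^{n+1} · t^{N−1}/(1−t^N) dt = (1/N)·( γ − Σ_{m=1}^{n+1} C(n+1,m)(−1)^m ψ(m/N) ) + Σ_{m=1}^{n+1} 1/m, where C(n+1,m) denotes the binomial coefficient. -/

import Mathlib

open MeasureTheory Set

/-- The digamma function `ψ(x) = Γ'(x)/Γ(x)`. -/
noncomputable def digamma (x : ℝ) : ℝ := deriv Real.Gamma x / Real.Gamma x

open Filter Topology

lemma aux_diff {x : ℝ} (hx : 0 < x) : DifferentiableAt ℝ Real.Gamma x :=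
  Real.differentiableAt_Gamma (fun m => by have : (0:ℝ) ≤ m := m.cast_nonneg; linarith)

lemma aux_logGamma {x : ℝ} (hx : 0 < x) :
    HasDerivAt (Real.log ∘ Real.Gamma) (digamma x) x := by
  have := (aux_diff hx).hasDerivAt.log (Real.Gamma_pos_of_pos hx).ne'
  exact this

lemma digamma_add_one {x : ℝ} (hx : 0 < x) : digamma (x+1) = digamma x + 1/x := by
  have h1 : HasDerivAt (fun y => (Real.log ∘ Real.Gamma) (y+1)) (digamma (x+1)) x :=
    (aux_logGamma (by linarith : 0 < x+1)).comp_add_const x 1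
  have h2 : HasDerivAt (fun y => (Real.log ∘ Real.Gamma) y + Real.log y) (digamma x + x⁻¹) x :=
    (aux_logGamma hx).add (Real.hasDerivAt_log hx.ne')
  have h3 : (fun y => (Real.log ∘ Real.Gamma) (y+1)) =ᶠ[𝓝 x]
      (fun y => (Real.log ∘ Real.Gamma) y + Real.log y) := by
    filter_upwards [lt_mem_nhds hx] with y hy
    simp only [Function.comp]
    rw [Real.Gamma_add_one hy.ne', Real.log_mul hy.ne' (Real.Gamma_pos_of_pos hy).ne']
    ring
  rw [one_div]
  exact h1.unique (h2.congr_of_eventuallyEq h3)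

lemma logGamma_slope {x : ℝ} (hx : 0 < x) :
    slope (Real.log ∘ Real.Gamma) x (x+1) = Real.log x := by
  simp only [slope_def_field, Function.comp]
  rw [Real.Gamma_add_one hx.ne', Real.log_mul hx.ne' (Real.Gamma_pos_of_pos hx).ne']
  ring_nf

lemma digamma_le_log {x : ℝ} (hx : 0 < x) : digamma x ≤ Real.log x := by
  rw [← logGamma_slope hx]
  exact Real.convexOn_log_Gamma.le_slope_of_hasDerivAt (mem_Ioi.2 hx)
    (mem_Ioi.2 (by linarith)) (by linarith) (aux_logGamma hx)

lemma log_le_digamma {x : ℝ} (hx : 0 < x) : Real.log x ≤ digamma (x+1) := by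
  rw [← logGamma_slope hx]
  exact Real.convexOn_log_Gamma.slope_le_of_hasDerivAt (mem_Ioi.2 hx)
    (mem_Ioi.2 (by linarith)) (by linarith) (aux_logGamma (by linarith))

lemma digamma_one : digamma 1 = - Real.eulerMascheroniConstant := by
  simp [digamma, Real.eulerMascheroniConstant_eq_neg_deriv]

lemma digamma_add_nat {x : ℝ} (hx : 0 < x) (K : ℕ) :
    digamma (x+K) = digamma x + ∑ k ∈ Finset.range K, 1/(x+k) := by
  induction K with
  | zero => simp
  | succ K ih =>
    rw [Finset.sum_range_succ, ← add_assoc, ← ih, ← digamma_add_one (by positivity)]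
    push_cast
    ring_nf

lemma log_shift (x : ℝ) :
    Tendsto (fun K : ℕ => Real.log (x+K) - Real.log K) atTop (𝓝 0) := by
  have h : Tendsto (fun K : ℕ => x / (K:ℝ) + 1) atTop (𝓝 (0+1)) :=
    (tendsto_const_div_atTop_nhds_zero_nat x).add_const 1
  rw [zero_add] at h
  have h2 := h.log one_ne_zero
  rw [Real.log_one] at h2
  refine h2.congr' ?_
  filter_upwards [eventually_gt_atTop 0, tendsto_natCast_atTop_atTop.eventually_gt_atTop (-x)]
    with K hK hx
  have hK' : (0:ℝ) < K := by exact_mod_cast hK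
  rw [← Real.log_div (by linarith) hK'.ne']
  congr 1
  field_simp

/-- Asymptotics giving the series for the digamma function. -/
lemma digamma_tendsto {x : ℝ} (hx : 1 ≤ x) :
    Tendsto (fun K : ℕ => Real.log K - ∑ k ∈ Finset.range K, 1/(x+k)) atTop (𝓝 (digamma x)) := by
  have h : Tendsto (fun K : ℕ => digamma (x+K) - Real.log K) atTop (𝓝 0) := by
    refine tendsto_of_tendsto_of_tendsto_of_le_of_le' (log_shift (x-1)) (log_shift x) ?_ ?_
    · filter_upwards [eventually_gt_atTop 0] with K hK
      have hK' : (0:ℝ) < K := by exact_mod_cast hK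
      have := log_le_digamma (by linarith : 0 < x - 1 + K)
      rw [show x - 1 + K + 1 = x + (K:ℝ) by ring] at this
      linarith
    · filter_upwards with K
      have := digamma_le_log (by positivity : 0 < x + (K:ℝ))
      linarith
  have h2 := (tendsto_const_nhds (x := digamma x)).sub h
  rw [sub_zero] at h2
  refine h2.congr (fun K => ?_)
  rw [digamma_add_nat (by linarith)]
  ring

lemma alt_sum (p : ℕ) (hp : 1 ≤ p) :
    ∑ m ∈ Finset.range (p+1), (p.choose m : ℝ) * (-1)^m = 0 := by
  have := add_pow (-1:ℝ) 1 p
  simp only [one_pow, mul_one] at this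
  rw [neg_add_cancel, zero_pow (by omega)] at this
  rw [this]
  exact Finset.sum_congr rfl fun m _ => mul_comm _ _

lemma harm_sum (p : ℕ) :
    ∑ m ∈ Finset.range p, (p.choose (m+1) : ℝ) * (-1)^(m+1) / ((m:ℝ)+1)
      = - ∑ m ∈ Finset.range p, (1:ℝ)/((m:ℝ)+1) := by
  induction p with
  | zero => simp
  | succ p ih =>
    have e : ∀ m : ℕ, ((p+1).choose (m+1) : ℝ) * (-1)^(m+1) / ((m:ℝ)+1)
        = (p.choose (m+1) : ℝ) * (-1)^(m+1) / ((m:ℝ)+1)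
          + ((p+1).choose (m+1) : ℝ) * (-1)^(m+1) / ((p:ℝ)+1) := by
      intro m
      have h1 : ((p+1).choose (m+1) : ℝ) = p.choose m + p.choose (m+1) := by
        exact_mod_cast Nat.choose_succ_succ p m
      have h2 : ((p:ℝ)+1) * p.choose m = (p+1).choose (m+1) * ((m:ℝ)+1) := by
        exact_mod_cast Nat.add_one_mul_choose_eq p m
      have : (m:ℝ)+1 ≠ 0 := by positivity
      have : (p:ℝ)+1 ≠ 0 := by positivity
      have h3 : ((p+1).choose (m+1) : ℝ) / ((p:ℝ)+1) = p.choose m / ((m:ℝ)+1) := by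
        field_simp; linarith
      rw [mul_div_right_comm _ _ ((p:ℝ)+1), h3, h1]
      ring
    rw [Finset.sum_congr rfl (fun m _ => e m), Finset.sum_add_distrib, ← Finset.sum_div]
    have h := alt_sum (p+1) (by omega)
    rw [Finset.sum_range_succ'] at h
    simp only [Nat.choose_zero_right, Nat.cast_one, pow_zero, mul_one] at h
    rw [eq_neg_of_add_eq_zero_left h, Finset.sum_range_succ, ih, Finset.sum_range_succ]
    simp only [Nat.choose_succ_self, Nat.cast_zero, zero_mul, zero_div]
    ring

lemma partial_integral (N p : ℕ) (hN : 1 ≤ N) (hp : 1 ≤ p) (K : ℕ) :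
    ∫ t in Ioo (0:ℝ) 1, (1-t)^p * (t^(N-1) * ∑ k ∈ Finset.range K, (t^N)^k)
     = -(1/N) * ∑ m ∈ Finset.range (p+1), ((p.choose m : ℝ) * (-1)^m) *
        (Real.log K - ∑ k ∈ Finset.range K, 1/(((m:ℝ)/N+1)+k)) := by
  have hN' : (0:ℝ) < N := by exact_mod_cast hN
  have e : ∀ t : ℝ, (1-t)^p * (t^(N-1) * ∑ k ∈ Finset.range K, (t^N)^k)
      = ∑ m ∈ Finset.range (p+1), ∑ k ∈ Finset.range K,
        ((p.choose m : ℝ) * (-1)^m) * t^(m+(N-1)+N*k) := by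
    intro t
    rw [show 1 - t = -t + 1 by ring, add_pow, Finset.sum_mul]
    refine Finset.sum_congr rfl fun m _ => ?_
    rw [Finset.mul_sum, Finset.mul_sum]
    refine Finset.sum_congr rfl fun k _ => ?_
    rw [neg_pow]
    ring
  rw [← integral_Ioc_eq_integral_Ioo, ← intervalIntegral.integral_of_le zero_le_one]
  simp_rw [e]
  rw [intervalIntegral.integral_finsetSum
    (fun m _ => Continuous.intervalIntegrable (by fun_prop) _ _)]
  simp_rw [mul_sub, Finset.sum_sub_distrib]
  rw [← Finset.sum_mul, alt_sum p hp, zero_mul, zero_sub, mul_neg, neg_mul, neg_neg, Finset.mul_sum]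
  refine Finset.sum_congr rfl fun m _ => ?_
  rw [intervalIntegral.integral_finsetSum
    (fun m _ => Continuous.intervalIntegrable (by fun_prop) _ _), Finset.mul_sum, Finset.mul_sum]
  refine Finset.sum_congr rfl fun k _ => ?_
  rw [intervalIntegral.integral_const_mul, integral_pow]
  have h : ((m+(N-1)+N*k : ℕ) : ℝ) + 1 = N * ((m:ℝ)/N+1+k) := by
    push_cast [Nat.cast_sub hN]
    field_simp
    ring
  rw [h, one_pow, zero_pow (by omega), sub_zero]
  have : (m:ℝ)/N+1+k ≠ 0 := by positivity
  field_simp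

lemma integral_tendsto (N p : ℕ) (hN : 1 ≤ N) (hp : 1 ≤ p) :
    Tendsto (fun K : ℕ =>
      ∫ t in Ioo (0:ℝ) 1, (1-t)^p * (t^(N-1) * ∑ k ∈ Finset.range K, (t^N)^k)) atTop
      (𝓝 (∫ t in Ioo (0:ℝ) 1, (1-t)^p * (t^(N-1) / (1 - t^N)))) := by
  refine tendsto_integral_of_dominated_convergence (fun _ => (1:ℝ)) ?_ ?_ ?_ ?_
  · intro K
    exact Continuous.aestronglyMeasurable (by fun_prop)
  · exact integrable_const _
  · intro K
    filter_upwards [ae_restrict_mem measurableSet_Ioo] with t ht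
    obtain ⟨h0, h1⟩ := ht
    have hs : 0 ≤ ∑ k ∈ Finset.range K, (t^N)^k := Finset.sum_nonneg fun k _ => by positivity
    have h1t : 0 ≤ 1 - t := by linarith
    rw [Real.norm_of_nonneg (by positivity)]
    have htN : t^N ≤ t := by simpa using pow_le_pow_of_le_one h0.le h1.le hN
    have hg : (1 - t^N) * ∑ k ∈ Finset.range K, (t^N)^k ≤ 1 := by
      rw [mul_neg_geom_sum]
      have : 0 ≤ (t^N)^K := by positivity
      linarith
    have hp1 : (1-t)^p ≤ 1 - t := by
      simpa using pow_le_pow_of_le_one h1t (by linarith) hp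
    have ht1 : t^(N-1) ≤ 1 := pow_le_one₀ h0.le h1.le
    calc _ ≤ (1 - t^N) * (1 * ∑ k ∈ Finset.range K, (t^N)^k) := by
          gcongr <;> linarith
      _ ≤ 1 := by rw [one_mul]; exact hg
  · filter_upwards [ae_restrict_mem measurableSet_Ioo] with t ht
    obtain ⟨h0, h1⟩ := ht
    have := (hasSum_geometric_of_lt_one (by positivity : 0 ≤ t^N)
      (pow_lt_one₀ h0.le h1 (by omega))).tendsto_sum_nat
    rw [div_eq_mul_inv]
    exact (this.const_mul _).const_mul _

/-- `∫₀¹ (1−t)^{n+1} t^{N−1}/(1−t^N) dt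
  = (1/N)(γ − Σ_{m=1}^{n+1} C(n+1,m)(−1)^m ψ(m/N)) + Σ_{m=1}^{n+1} 1/m`. -/
theorem integral_I2_formula (N n : ℕ) (hN : 1 ≤ N) (hn : 1 ≤ n) :
    ∫ t in Ioo (0:ℝ) 1, (1-t)^(n+1) * (t^(N-1) / (1 - t^N)) =
      (1/N) * (Real.eulerMascheroniConstant
        - ∑ m ∈ Finset.Icc 1 (n+1), ((n+1).choose m : ℝ) * (-1)^m * digamma (m/N))
      + ∑ m ∈ Finset.Icc 1 (n+1), (1 : ℝ)/m := by
  have hN' : (0:ℝ) < N := by exact_mod_cast hN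
  have h1 := integral_tendsto N (n+1) hN (by omega)
  simp_rw [partial_integral N (n+1) hN (by omega)] at h1
  have h2 := (tendsto_finsetSum (Finset.range (n+1+1)) (fun m _ =>
    (digamma_tendsto (x := (m:ℝ)/N+1) (by
      have : 0 ≤ (m:ℝ)/N := by positivity
      linarith)).const_mul
      (((n+1).choose m : ℝ) * (-1)^m))).const_mul (-(1/(N:ℝ)))
  rw [tendsto_nhds_unique h1 h2, Finset.sum_range_succ']
  have hI : ∀ f : ℕ → ℝ, ∑ m ∈ Finset.Icc 1 (n+1), f m = ∑ m ∈ Finset.range (n+1), f (m+1) := by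
    intro f
    rw [Finset.range_eq_Ico, Finset.sum_Ico_add' f 0 (n+1) 1]
    rfl
  rw [hI, hI]
  have e : ∀ m : ℕ, ((n+1).choose (m+1) : ℝ) * (-1)^(m+1) * digamma (((m+1:ℕ):ℝ)/N+1)
      = ((n+1).choose (m+1) : ℝ) * (-1)^(m+1) * digamma (((m+1:ℕ):ℝ)/N)
        + N * (((n+1).choose (m+1) : ℝ) * (-1)^(m+1) / ((m:ℝ)+1)) := by
    intro m
    rw [digamma_add_one (by positivity)]
    push_cast
    field_simp
  rw [Finset.sum_congr rfl (fun m _ => e m), Finset.sum_add_distrib, ← Finset.mul_sum, harm_sum]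
  simp only [Nat.cast_zero, zero_div, zero_add, digamma_one, Nat.cast_add, Nat.cast_one]
  simp
  field_simp
  ring
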